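/- Let P and Q be compact metric spaces, let f : P×Q → ℝⁿ be continuous, and let s ∈ ℝⁿ. Then the infimum over Borel probability measures μ on P of the supremum over Borel probability measures ν on Q of ∫_P ∫_Q ⟨s, f(u,v)⟩ dν(v) dμ(u) equals the supremum over ν of the infimum over μ of the same double integral; moreover both the outer infimum and the outer supremum are attained. -/

import Mathlib

open Set Filter MeasureTheory
open scoped RealInnerProductSpace

noncomputable section

/-- Minimax theorem for convex-concave-like payoffs: a separately continuous payoff on compact
strategy spaces has a saddle point as soon as convex combinations of strategies of each player can
be realised by strategies of that player. -/
theorem exists_saddlePoint_of_convexLike {A B : Type*} [TopologicalSpace A] [CompactSpace A]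
    [Nonempty A] [TopologicalSpace B] [CompactSpace B] [Nonempty B] {K : A → B → ℝ}
    (hA : ∀ b, Continuous fun a => K a b) (hB : ∀ a, Continuous (K a))
    (hA' : ∀ a a' (s t : ℝ), 0 ≤ s → 0 ≤ t → s + t = 1 →
      ∃ c, ∀ b, K c b = s * K a b + t * K a' b)
    (hB' : ∀ b b' (s t : ℝ), 0 ≤ s → 0 ≤ t → s + t = 1 →
      ∃ c, ∀ a, K a c = s * K a b + t * K a b') :
    ∃ a₀ b₀, ∀ a b, K a₀ b ≤ K a b₀ := by
  let G : B → A → ℝ := fun b a => K a b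
  let Φ : (B → ℝ) → (A → ℝ) → ℝ := fun x y => x (Function.invFun G y)
  have hG : ∀ b, G (Function.invFun G (G b)) = G b := fun b => Function.invFun_eq ⟨b, rfl⟩
  have hΦ : ∀ a, ∀ y ∈ range G, Φ (K a) y = y a := by
    rintro a _ ⟨b, rfl⟩
    exact congrFun (hG b) a
  have hX : Convex ℝ (range K) := by
    rintro _ ⟨a, rfl⟩ _ ⟨a', rfl⟩ s t hs ht hst
    obtain ⟨c, hc⟩ := hA' a a' s t hs ht hst
    exact ⟨c, funext fun b => by simp [hc b]⟩
  have hY : Convex ℝ (range G) := by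
    rintro _ ⟨b, rfl⟩ _ ⟨b', rfl⟩ s t hs ht hst
    obtain ⟨c, hc⟩ := hB' b b' s t hs ht hst
    exact ⟨c, funext fun a => by simp [G, hc a]⟩
  have key : ∃ x ∈ range K, ∃ y ∈ range G, IsSaddlePointOn (range K) (range G) Φ x y := by
    refine Sion.exists_isSaddlePointOn (range_nonempty K) hX
      (isCompact_range (continuous_pi hA)) ?_ ?_ hY (range_nonempty G)
      (isCompact_range (continuous_pi hB)) ?_ ?_
    · intro y _
      exact (continuous_apply (Function.invFun G y)).continuousOn.lowerSemicontinuousOn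
    · intro y _
      exact ((LinearMap.proj (R := ℝ) (φ := fun _ : B => ℝ)
        (Function.invFun G y)).convexOn hX).quasiconvexOn
    · rintro _ ⟨a, rfl⟩
      exact ((continuous_apply a).continuousOn.congr (hΦ a)).upperSemicontinuousOn
    · rintro _ ⟨a, rfl⟩
      exact (((LinearMap.proj (R := ℝ) (φ := fun _ : A => ℝ) a).concaveOn hY).congr
        fun y hy => (hΦ a y hy).symm).quasiconcaveOn
  obtain ⟨_, ⟨a₀, rfl⟩, _, ⟨b₀, rfl⟩, h⟩ := key
  refine ⟨a₀, b₀, fun a b => ?_⟩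
  simpa [hΦ, G] using h (K a) ⟨a, rfl⟩ (G b) ⟨b, rfl⟩

/-- A saddle point gives the equality of the lower and upper values of a game, and both outer
extrema are attained at it. -/
theorem sInf_sSup_eq_of_saddlePoint {A B : Type*} {K : A → B → ℝ}
    (hA : ∀ b, BddBelow (range fun a => K a b)) (hB : ∀ a, BddAbove (range (K a)))
    {a₀ : A} {b₀ : B} (h : ∀ a b, K a₀ b ≤ K a b₀) :
    sInf (range fun a => sSup (range fun b => K a b)) =
        sSup (range fun b => sInf (range fun a => K a b)) ∧
      sSup (range fun b => K a₀ b) = sInf (range fun a => sSup (range fun b => K a b)) ∧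
      sInf (range fun a => K a b₀) = sSup (range fun b => sInf (range fun a => K a b)) := by
  have h1 : sSup (range fun b => K a₀ b) = K a₀ b₀ :=
    IsGreatest.csSup_eq ⟨⟨b₀, rfl⟩, forall_mem_range.2 fun b => h a₀ b⟩
  have h2 : sInf (range fun a => K a b₀) = K a₀ b₀ :=
    IsLeast.csInf_eq ⟨⟨a₀, rfl⟩, forall_mem_range.2 fun a => h a b₀⟩
  have h3 : sInf (range fun a => sSup (range fun b => K a b)) = K a₀ b₀ :=
    IsLeast.csInf_eq ⟨⟨a₀, h1⟩, forall_mem_range.2 fun a =>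
      (h a b₀).trans (le_csSup (hB a) ⟨b₀, rfl⟩)⟩
  have h4 : sSup (range fun b => sInf (range fun a => K a b)) = K a₀ b₀ :=
    IsGreatest.csSup_eq ⟨⟨b₀, h2⟩, forall_mem_range.2 fun b =>
      (csInf_le (hA b) ⟨a₀, rfl⟩).trans (h a₀ b)⟩
  exact ⟨h3.trans h4.symm, h1.trans h3.symm, h2.trans h4.symm⟩

/-- Probability measures are closed under convex combinations, and integration of integrable
functions is affine along them. -/
theorem MeasureTheory.ProbabilityMeasure.exists_integral_eq_convexCombination {Ω : Type*}
    [MeasurableSpace Ω] (μ ν : ProbabilityMeasure Ω) {s t : ℝ} (hs : 0 ≤ s) (ht : 0 ≤ t)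
    (hst : s + t = 1) :
    ∃ ρ : ProbabilityMeasure Ω, ∀ g : Ω → ℝ, Integrable g (μ : Measure Ω) →
      Integrable g (ν : Measure Ω) →
      ∫ x, g x ∂(ρ : Measure Ω) =
        s * ∫ x, g x ∂(μ : Measure Ω) + t * ∫ x, g x ∂(ν : Measure Ω) := by
  refine ⟨⟨ENNReal.ofReal s • (μ : Measure Ω) + ENNReal.ofReal t • (ν : Measure Ω), ⟨?_⟩⟩,
    fun g hμ hν => ?_⟩
  · simp [← ENNReal.ofReal_add hs ht, hst]
  · rw [ProbabilityMeasure.coe_mk, integral_add_measure (hμ.smul_measure ENNReal.ofReal_ne_top)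
      (hν.smul_measure ENNReal.ofReal_ne_top), integral_smul_measure, integral_smul_measure,
      ENNReal.toReal_ofReal hs, ENNReal.toReal_ofReal ht, smul_eq_mul, smul_eq_mul]

/-- Integrating one variable of a continuous function on a compact product against a finite measure
yields a continuous function of the other variable. -/
theorem continuous_integral_right_of_compactSpace {X Y : Type*} [TopologicalSpace X]
    [FirstCountableTopology X] [CompactSpace X] [TopologicalSpace Y] [CompactSpace Y]
    [SecondCountableTopology Y] [MeasurableSpace Y] [OpensMeasurableSpace Y] (ν : Measure Y)
    [IsFiniteMeasure ν] {c : X → Y → ℝ} (hc : Continuous (Function.uncurry c)) :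
    Continuous fun x => ∫ y, c x y ∂ν := by
  obtain ⟨C, hC⟩ := isCompact_univ.exists_bound_of_continuousOn hc.continuousOn
  exact continuous_of_dominated (bound := fun _ => C)
    (fun x => (hc.comp (Continuous.prodMk_right x)).aestronglyMeasurable)
    (fun x => ae_of_all _ fun y => hC (x, y) (mem_univ _)) (integrable_const C)
    (ae_of_all _ fun y => hc.comp (Continuous.prodMk_left y))

/-- The Isaacs condition holds for the mixed (relaxed) extension of the game: the
inf over mixed strategies of player I of the sup over mixed strategies of player II of the
averaged Hamiltonian `⟨s, f⟩` equals the sup-inf, and both outer extrema are attained. -/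
theorem mixed_extension_isaacs
    {n : ℕ} (P Q : Type*)
    [MetricSpace P] [CompactSpace P] [Nonempty P] [MeasurableSpace P] [BorelSpace P]
    [MetricSpace Q] [CompactSpace Q] [Nonempty Q] [MeasurableSpace Q] [BorelSpace Q]
    (f : P → Q → EuclideanSpace ℝ (Fin n))
    (hf : Continuous (fun z : P × Q => f z.1 z.2))
    (s : EuclideanSpace ℝ (Fin n)) :
    (sInf (Set.range fun μ : ProbabilityMeasure P =>
        sSup (Set.range fun ν : ProbabilityMeasure Q =>
          ∫ u, ∫ v, ⟪s, f u v⟫ ∂(ν : Measure Q) ∂(μ : Measure P))) =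
      sSup (Set.range fun ν : ProbabilityMeasure Q =>
        sInf (Set.range fun μ : ProbabilityMeasure P =>
          ∫ u, ∫ v, ⟪s, f u v⟫ ∂(ν : Measure Q) ∂(μ : Measure P)))) ∧
    (∃ μ₀ : ProbabilityMeasure P,
      sSup (Set.range fun ν : ProbabilityMeasure Q =>
          ∫ u, ∫ v, ⟪s, f u v⟫ ∂(ν : Measure Q) ∂(μ₀ : Measure P)) =
        sInf (Set.range fun μ : ProbabilityMeasure P =>
          sSup (Set.range fun ν : ProbabilityMeasure Q =>
            ∫ u, ∫ v, ⟪s, f u v⟫ ∂(ν : Measure Q) ∂(μ : Measure P)))) ∧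
    (∃ ν₀ : ProbabilityMeasure Q,
      sInf (Set.range fun μ : ProbabilityMeasure P =>
          ∫ u, ∫ v, ⟪s, f u v⟫ ∂(ν₀ : Measure Q) ∂(μ : Measure P)) =
        sSup (Set.range fun ν : ProbabilityMeasure Q =>
          sInf (Set.range fun μ : ProbabilityMeasure P =>
            ∫ u, ∫ v, ⟪s, f u v⟫ ∂(ν : Measure Q) ∂(μ : Measure P)))) := by
  have hc : Continuous (Function.uncurry fun u v => ⟪s, f u v⟫) := continuous_const.inner hf
  have hP (ν : ProbabilityMeasure Q) : Continuous fun u => ∫ v, ⟪s, f u v⟫ ∂(ν : Measure Q) :=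
    continuous_integral_right_of_compactSpace _ hc
  have hQ (μ : ProbabilityMeasure P) : Continuous fun v => ∫ u, ⟪s, f u v⟫ ∂(μ : Measure P) :=
    continuous_integral_right_of_compactSpace (c := fun v u => ⟪s, f u v⟫) _
      (hc.comp continuous_swap)
  have hswap (μ : ProbabilityMeasure P) (ν : ProbabilityMeasure Q) :
      ∫ u, ∫ v, ⟪s, f u v⟫ ∂(ν : Measure Q) ∂(μ : Measure P) =
        ∫ v, ∫ u, ⟪s, f u v⟫ ∂(μ : Measure P) ∂(ν : Measure Q) :=
    integral_integral_swap (hc.integrable_of_hasCompactSupport (.of_compactSpace _))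
  have hPint (μ : ProbabilityMeasure P) (ν : ProbabilityMeasure Q) :
      Integrable (fun u => ∫ v, ⟪s, f u v⟫ ∂(ν : Measure Q)) (μ : Measure P) :=
    (hP ν).integrable_of_hasCompactSupport (.of_compactSpace _)
  have hQint (μ : ProbabilityMeasure P) (ν : ProbabilityMeasure Q) :
      Integrable (fun v => ∫ u, ⟪s, f u v⟫ ∂(μ : Measure P)) (ν : Measure Q) :=
    (hQ μ).integrable_of_hasCompactSupport (.of_compactSpace _)
  have hcontP (ν : ProbabilityMeasure Q) : Continuous fun μ : ProbabilityMeasure P =>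
      ∫ u, ∫ v, ⟪s, f u v⟫ ∂(ν : Measure Q) ∂(μ : Measure P) :=
    ProbabilityMeasure.continuous_integral_continuousMap (⟨_, hP ν⟩ : C(P, ℝ))
  have hcontQ (μ : ProbabilityMeasure P) : Continuous fun ν : ProbabilityMeasure Q =>
      ∫ u, ∫ v, ⟪s, f u v⟫ ∂(ν : Measure Q) ∂(μ : Measure P) := by
    simp only [hswap]
    exact ProbabilityMeasure.continuous_integral_continuousMap (⟨_, hQ μ⟩ : C(Q, ℝ))
  have : Nonempty (ProbabilityMeasure P) := ⟨⟨.dirac (Classical.arbitrary P), inferInstance⟩⟩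
  have : Nonempty (ProbabilityMeasure Q) := ⟨⟨.dirac (Classical.arbitrary Q), inferInstance⟩⟩
  obtain ⟨μ₀, ν₀, h⟩ := exists_saddlePoint_of_convexLike hcontP hcontQ
    (fun μ μ' a b ha hb hab => by
      obtain ⟨ρ, hρ⟩ := μ.exists_integral_eq_convexCombination μ' ha hb hab
      exact ⟨ρ, fun ν => hρ _ (hPint μ ν) (hPint μ' ν)⟩)
    (fun ν ν' a b ha hb hab => by
      obtain ⟨ρ, hρ⟩ := ν.exists_integral_eq_convexCombination ν' ha hb hab
      refine ⟨ρ, fun μ => ?_⟩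
      rw [hswap, hswap, hswap]
      exact hρ _ (hQint μ ν) (hQint μ ν'))
  obtain ⟨h₁, h₂, h₃⟩ := sInf_sSup_eq_of_saddlePoint
    (fun ν => (isCompact_range (hcontP ν)).bddBelow)
    (fun μ => (isCompact_range (hcontQ μ)).bddAbove) h
  exact ⟨h₁, ⟨μ₀, h₂⟩, ⟨ν₀, h₃⟩⟩
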